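/- Let k ≥ 1, let ϑ be a kth-order shape process, and let ζ^ϑ be its derived (k−1)st-order childtype process. Then for every full binary tree t, P_ϑ[t] = P_{ζ^ϑ}[t]. -/

import Mathlib

inductive BinTree : Type where
  | leaf : BinTree
  | node : BinTree → BinTree → BinTree
deriving DecidableEq

/-- Update a length-`k` shape-history by appending the newest direction and
dropping the oldest one. -/
def pushDir (z : List Bool) (b : Bool) : List Bool := (z ++ [b]).tail

/-- `shapeProbAux ϑ t z` = product over all nodes `v` of the full binary tree
`t` of `ϑ (k-shape-history of v) (type v)`, where `z` is the k-shape-history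
of the root and type is 0 for a leaf and 2 for an inner node.
(Here `BinTree.leaf` is a *leaf node*: `BinTree` is exactly the type of full
binary trees.) -/
noncomputable def shapeProbAux (ϑ : List Bool → ℕ → ℝ) : BinTree → List Bool → ℝ
  | .leaf, z => ϑ z 0
  | .node l r, z =>
      ϑ z 2 * shapeProbAux ϑ l (pushDir z false) * shapeProbAux ϑ r (pushDir z true)

/-- Probability assigned to a full binary tree by a kth-order shape process
(shape-histories of too-shallow nodes are padded with 0's, i.e. `false`). -/
noncomputable def shapeProb (k : ℕ) (ϑ : List Bool → ℕ → ℝ) (t : BinTree) : ℝ :=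
  shapeProbAux ϑ t (List.replicate k false)

/-- The childtype of an inner node with subtrees `l`, `r`: 0 if both children
are leaves, 1 if only the left child is a leaf, 2 if only the right child is
a leaf, 3 if both children are inner nodes. -/
def childtype : BinTree → BinTree → ℕ
  | .leaf, .leaf => 0
  | .leaf, .node _ _ => 1
  | .node _ _, .leaf => 2
  | .node _ _, .node _ _ => 3

/-- Product over all inner nodes `v` of `ζ (j-shape-history of v) (childtype v)`,
where `z` is the j-shape-history of the root. -/
noncomputable def childtypeProbAux (ζ : List Bool → ℕ → ℝ) : BinTree → List Bool → ℝ
  | .leaf, _ => 1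
  | .node l r, z =>
      ζ z (childtype l r) * childtypeProbAux ζ l (pushDir z false) *
        childtypeProbAux ζ r (pushDir z true)

/-- Probability assigned to a full binary tree by a jth-order childtype
process `(nz, ζ)`: `1 - nz` for the single-node tree, and
`nz · ∏_{inner v} ζ_{h_j^s(v)}(childtype v)` otherwise. -/
noncomputable def childtypeProb (j : ℕ) (nz : ℝ) (ζ : List Bool → ℕ → ℝ) :
    BinTree → ℝ
  | .leaf => 1 - nz
  | .node l r => nz * childtypeProbAux ζ (.node l r) (List.replicate j false)

/-- The (k−1)st-order childtype process derived from a kth-order shape process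
`ϑ` (this is the `ζ^ϑ` part; the `n_ζ` part is `ϑ 0^k 2`). -/
noncomputable def derivedZeta (ϑ : List Bool → ℕ → ℝ) (z : List Bool) : ℕ → ℝ
  | 0 => ϑ (z ++ [false]) 0 * ϑ (z ++ [true]) 0
  | 1 => ϑ (z ++ [false]) 0 * ϑ (z ++ [true]) 2
  | 2 => ϑ (z ++ [false]) 2 * ϑ (z ++ [true]) 0
  | 3 => ϑ (z ++ [false]) 2 * ϑ (z ++ [true]) 2
  | _ => 0

/-- The type of the root: 0 for a leaf, 2 for an inner node. -/
def rootType : BinTree → ℕ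
  | .leaf => 0
  | .node _ _ => 2

theorem derivedZeta_childtype (ϑ : List Bool → ℕ → ℝ) (z : List Bool) (l r : BinTree) :
    derivedZeta ϑ z (childtype l r) =
      ϑ (z ++ [false]) (rootType l) * ϑ (z ++ [true]) (rootType r) := by
  cases l <;> cases r <;> rfl

theorem shapeProbAux_eq (ϑ : List Bool → ℕ → ℝ) (t : BinTree) :
    ∀ z : List Bool, z ≠ [] →
      shapeProbAux ϑ t z = ϑ z (rootType t) * childtypeProbAux (derivedZeta ϑ) t z.tail := by
  induction t with
  | leaf => intro z _; simp [shapeProbAux, childtypeProbAux, rootType]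
  | node l r ihl ihr =>
    intro z hz
    have hp : ∀ b, pushDir z b = z.tail ++ [b] := by
      intro b
      cases z with
      | nil => exact absurd rfl hz
      | cons c w => rfl
    have ht : ∀ b, (z.tail ++ [b]).tail = pushDir z.tail b := fun _ => rfl
    simp only [shapeProbAux, childtypeProbAux, hp]
    rw [ihl _ (by simp), ihr _ (by simp), derivedZeta_childtype, ht, ht]
    simp only [rootType]
    ring

/-- for every kth-order shape process `ϑ` (k ≥ 1) and every
full binary tree `t`, `P_ϑ[t] = P_{ζ^ϑ}[t]` where `ζ^ϑ` is the derived
(k−1)st-order childtype process. -/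
theorem statement15 (k : ℕ) (hk : 1 ≤ k) (ϑ : List Bool → ℕ → ℝ)
    (hϑ : ∀ z : List Bool, z.length = k →
      0 ≤ ϑ z 0 ∧ 0 ≤ ϑ z 2 ∧ ϑ z 0 + ϑ z 2 = 1)
    (t : BinTree) :
    shapeProb k ϑ t =
      childtypeProb (k - 1) (ϑ (List.replicate k false) 2) (derivedZeta ϑ) t := by
  cases t with
  | leaf =>
    have h := (hϑ (List.replicate k false) (by simp)).2.2
    simp only [shapeProb, shapeProbAux, childtypeProb]
    linarith
  | node l r =>
    have hne : List.replicate k false ≠ [] := by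
      simp only [ne_eq, List.replicate_eq_nil_iff]; omega
    unfold shapeProb
    rw [shapeProbAux_eq ϑ _ _ hne, List.tail_replicate]
    rfl
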